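/- Let p ≥ 2, α = p−1 and θ ≥ 0. At the critical value μ = μ_{α,θ} the subcritical supremum blows up: TMSC(μ_{α,θ},α,θ) = ∞, i.e. the quantities ‖u‖_{L^p_θ}^{-p} ∫₀^∞ φ_p(μ_{α,θ}|u|^{p/(p−1)}) dλ_θ, taken over u ∈ X with u ≠ 0 and ‖u′‖_{L^p_α} ≤ 1, are unbounded. -/

import Mathlib

open MeasureTheory Real Filter ENNReal

/-- The fractional-dimension spherical volume constant `ω_θ = 2π^((θ+1)/2)/Γ((θ+1)/2)`. -/
noncomputable def omegaW (θ : ℝ) : ℝ := 2 * Real.pi ^ ((θ + 1) / 2) / Real.Gamma ((θ + 1) / 2)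

/-- Weighted integral `∫₀^∞ f dλ_θ = ω_θ ∫₀^∞ f(r) r^θ dr` (for nonnegative integrands,
valued in `ℝ≥0∞`). -/
noncomputable def wInt (θ : ℝ) (f : ℝ → ℝ) : ℝ≥0∞ :=
  ENNReal.ofReal (omegaW θ) *
    ∫⁻ r in Set.Ioi (0 : ℝ), ENNReal.ofReal (f r) * ENNReal.ofReal (r ^ θ)

/-- The weighted Lebesgue norm `‖u‖_{L^q_θ}` (valued in `ℝ≥0∞`). -/
noncomputable def wNorm (θ q : ℝ) (u : ℝ → ℝ) : ℝ≥0∞ :=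
  (wInt θ fun r => |u r| ^ q) ^ (1 / q)

/-- Membership in the weighted Sobolev space `X = X^{1,p}_∞(α,θ)`:
`u` is locally absolutely continuous on `(0,∞)` with a.e. derivative `u'`
(expressed through the fundamental theorem of calculus on compact subintervals),
`u(r) → 0` as `r → ∞`, `‖u‖_{L^p_θ} < ∞` and `‖u'‖_{L^p_α} < ∞`. -/
structure MemX (p α θ : ℝ) (u u' : ℝ → ℝ) : Prop where
  ftc_int : ∀ a b : ℝ, 0 < a → a ≤ b → IntervalIntegrable u' MeasureTheory.volume a b
  ftc : ∀ a b : ℝ, 0 < a → a ≤ b → u b - u a = ∫ t in a..b, u' t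
  lim_zero : Filter.Tendsto u Filter.atTop (nhds 0)
  fin_u : wNorm θ p u < ⊤
  fin_u' : wNorm α p u' < ⊤

/-- Full norm on `X`: `‖u‖ = (‖u‖_{L^p_θ}^p + ‖u'‖_{L^p_α}^p)^{1/p}`. -/
noncomputable def Xnorm (p α θ : ℝ) (u u' : ℝ → ℝ) : ℝ≥0∞ :=
  ((wNorm θ p u) ^ p + (wNorm α p u') ^ p) ^ (1 / p)

/-- The truncated exponential `φ_p(t) = Σ_{j ∈ ℕ, j ≥ p-1} t^j / j!`. -/
noncomputable def phiP (p t : ℝ) : ℝ :=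
  ∑' j : ℕ, if p - 1 ≤ (j : ℝ) then t ^ j / (Nat.factorial j : ℝ) else 0

/-- The critical constant `μ_{α,θ} = (θ+1) ω_α^{1/α}`. -/
noncomputable def muC (α θ : ℝ) : ℝ := (θ + 1) * (omegaW α) ^ (1 / α)

/-- The Trudinger–Moser functional `∫₀^∞ φ_p(μ |u|^{p/(p-1)}) dλ_θ`. -/
noncomputable def TMfunc (p θ μ : ℝ) (u : ℝ → ℝ) : ℝ≥0∞ :=
  wInt θ fun r => phiP p (μ * |u r| ^ (p / (p - 1)))

/-- The subcritical Trudinger–Moser supremum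
`TMSC(μ,α,θ) = sup { ‖u‖_{L^p_θ}^{-p} ∫₀^∞ φ_p(μ|u|^{p/(p-1)}) dλ_θ : u ∈ X, u ≠ 0, ‖u'‖_{L^p_α} ≤ 1 }`. -/
noncomputable def TMSC (p α θ μ : ℝ) : ℝ≥0∞ :=
  ⨆ (u : ℝ → ℝ) (u' : ℝ → ℝ) (_ : MemX p α θ u u') (_ : u ≠ 0)
    (_ : wNorm α p u' ≤ 1), (wNorm θ p u) ^ (-p) * TMfunc p θ μ u

/-- The critical Trudinger–Moser supremum
`TMC(σ,α,θ) = sup { ∫₀^∞ φ_p(σ|u|^{p/(p-1)}) dλ_θ : u ∈ X, ‖u‖ ≤ 1 }`. -/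
noncomputable def TMC (p α θ σ : ℝ) : ℝ≥0∞ :=
  ⨆ (u : ℝ → ℝ) (u' : ℝ → ℝ) (_ : MemX p α θ u u') (_ : Xnorm p α θ u u' ≤ 1),
    TMfunc p θ σ u

/-- `k₀ = min { j ∈ ℕ : j ≥ p - 1 }`. -/
noncomputable def k0 (p : ℝ) : ℕ := sInf {j : ℕ | p - 1 ≤ (j : ℝ)}

/-- `TMC(σ,α,θ)` is attained by some `u ∈ X` with `‖u‖ ≤ 1`. -/
def TMCAttained (p α θ σ : ℝ) : Prop :=
  ∃ u u' : ℝ → ℝ, MemX p α θ u u' ∧ Xnorm p α θ u u' ≤ 1 ∧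
    TMC p α θ σ = TMfunc p θ σ u

/-- `σ_* = inf { σ ∈ (0, μ_{α,θ}) : TMC(σ,α,θ) is attained }`. -/
noncomputable def sigmaStar (p α θ : ℝ) : ℝ :=
  sInf {σ : ℝ | σ ∈ Set.Ioo 0 (muC α θ) ∧ TMCAttained p α θ σ}

lemma omegaW_pos {θ : ℝ} (hθ : 0 ≤ θ) : 0 < omegaW θ := by
  have : 0 < Real.Gamma ((θ + 1) / 2) := Real.Gamma_pos_of_pos (by linarith)
  unfold omegaW
  positivity

/-- Moser's function of depth `L` and slope `d`: `d · log (1/r)` truncated to `[0, d L]`. -/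
noncomputable def moser (d L r : ℝ) : ℝ := d * min L (max 0 (-Real.log r))

/-- The almost everywhere derivative of `moser d L`. -/
noncomputable def moserDeriv (d L : ℝ) : ℝ → ℝ :=
  Set.indicator (Set.Ioo (Real.exp (-L)) 1) fun r => -d * r⁻¹

lemma moser_of_one_le {d L r : ℝ} (hL : 0 ≤ L) (hr : 1 ≤ r) : moser d L r = 0 := by
  have := Real.log_nonneg hr
  rw [moser, max_eq_left (by linarith), min_eq_right hL, mul_zero]

lemma moser_of_le_exp {d L r : ℝ} (hr0 : 0 < r) (hr : r ≤ Real.exp (-L)) :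
    moser d L r = d * L := by
  have := (Real.log_le_iff_le_exp hr0).2 hr
  rw [moser, min_eq_left (le_max_of_le_right (by linarith))]

lemma moser_of_mem_Icc {d L r : ℝ} (hr : r ∈ Set.Icc (Real.exp (-L)) 1) :
    moser d L r = -d * Real.log r := by
  have hr0 : 0 < r := (Real.exp_pos _).trans_le hr.1
  have h1 := (Real.le_log_iff_exp_le hr0).2 hr.1
  have h2 := Real.log_nonpos hr0.le hr.2
  rw [moser, max_eq_right (by linarith), min_eq_right (by linarith)]
  ring

lemma moser_nonneg {d L : ℝ} (hd : 0 ≤ d) (hL : 0 ≤ L) (r : ℝ) : 0 ≤ moser d L r :=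
  mul_nonneg hd (le_min hL (le_max_left _ _))

lemma continuousOn_moser (d L : ℝ) : ContinuousOn (moser d L) (Set.Ioi 0) := by
  have h : ContinuousOn Real.log (Set.Ioi 0) :=
    Real.continuousOn_log.mono fun x (hx : 0 < x) => hx.ne'
  unfold moser
  fun_prop

lemma integrable_moserDeriv (d L : ℝ) : Integrable (moserDeriv d L) := by
  refine (integrable_indicator_iff measurableSet_Ioo).2 ?_
  refine IntegrableOn.mono_set ?_ Set.Ioo_subset_Icc_self
  refine ContinuousOn.integrableOn_Icc (continuousOn_const.mul (continuousOn_id.inv₀ ?_))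
  exact fun x hx => ((Real.exp_pos _).trans_le hx.1).ne'

lemma hasDerivAt_moser {d L r : ℝ} (hL : 0 < L) (hr : 0 < r) (h1 : r ≠ Real.exp (-L))
    (h2 : r ≠ 1) : HasDerivAt (moser d L) (moserDeriv d L r) r := by
  have hexp : Real.exp (-L) < 1 := Real.exp_lt_one_iff.2 (by linarith)
  rcases lt_or_gt_of_ne h1 with h | h
  · have : moserDeriv d L r = 0 := Set.indicator_of_notMem (fun hx => by linarith [hx.1]) _
    rw [this]
    refine (hasDerivAt_const r (d * L)).congr_of_eventuallyEq ?_
    filter_upwards [Ioo_mem_nhds hr h] with x hx using moser_of_le_exp hx.1 hx.2.le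
  rcases lt_or_gt_of_ne h2 with h' | h'
  · have : moserDeriv d L r = -d * r⁻¹ := Set.indicator_of_mem (Set.mem_Ioo.2 ⟨h, h'⟩) _
    rw [this]
    refine ((Real.hasDerivAt_log hr.ne').const_mul (-d)).congr_of_eventuallyEq ?_
    filter_upwards [Icc_mem_nhds h h'] with x hx using moser_of_mem_Icc hx
  · have : moserDeriv d L r = 0 := Set.indicator_of_notMem (fun hx => by linarith [hx.2]) _
    rw [this]
    refine (hasDerivAt_const r (0 : ℝ)).congr_of_eventuallyEq ?_
    filter_upwards [Ioi_mem_nhds h'] with x hx using moser_of_one_le hL.le (le_of_lt hx)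

lemma moser_sub_moser {d L a b : ℝ} (hL : 0 < L) (ha : 0 < a) (hab : a ≤ b) :
    moser d L b - moser d L a = ∫ t in a..b, moserDeriv d L t := by
  symm
  refine MeasureTheory.integral_eq_of_hasDerivAt_off_countable_of_le _ _ hab
    (s := {Real.exp (-L), 1}) (Set.Countable.insert _ (Set.countable_singleton _))
    ((continuousOn_moser d L).mono fun x hx => ha.trans_le hx.1) ?_
    (integrable_moserDeriv d L).intervalIntegrable
  rintro x ⟨hx, hxs⟩
  simp only [Set.mem_insert_iff, Set.mem_singleton_iff, not_or] at hxs
  exact hasDerivAt_moser hL (ha.trans hx.1) hxs.1 hxs.2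

lemma neg_log_rpow_le {p r : ℝ} (hp : 0 < p) (hr0 : 0 < r) (hr1 : r ≤ 1) :
    (-Real.log r) ^ p ≤ (2 * p) ^ p * r ^ (-(1 / 2) : ℝ) := by
  have h := Real.log_le_rpow_div (inv_nonneg.2 hr0.le) (ε := 1 / (2 * p)) (by positivity)
  rw [Real.log_inv] at h
  have hl := Real.log_nonpos hr0.le hr1
  calc (-Real.log r) ^ p ≤ (r⁻¹ ^ (1 / (2 * p)) / (1 / (2 * p))) ^ p :=
        Real.rpow_le_rpow (by linarith) h hp.le
    _ = (2 * p) ^ p * r ^ (-(1 / 2) : ℝ) := by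
        rw [div_div_eq_mul_div, div_one, Real.mul_rpow (by positivity) (by positivity),
          ← Real.rpow_mul (by positivity), Real.inv_rpow hr0.le, Real.rpow_neg hr0.le, mul_comm]
        congr 3
        field_simp

lemma wInt_moser_rpow_le {p θ d L : ℝ} (hp : 0 < p) (hθ : 0 ≤ θ) (hd : 0 ≤ d) (hL : 0 ≤ L) :
    wInt θ (fun r => |moser d L r| ^ p) ≤
      ENNReal.ofReal (omegaW θ * (d ^ p * (2 * (2 * p) ^ p))) := by
  rw [wInt, ENNReal.ofReal_mul (omegaW_pos hθ).le]
  gcongr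
  have hint : IntegrableOn (fun r : ℝ => r ^ (-(1 / 2) : ℝ)) (Set.Ioc 0 1) :=
    (intervalIntegrable_iff_integrableOn_Ioc_of_le zero_le_one).1
      (intervalIntegral.intervalIntegrable_rpow' (by norm_num))
  have hval : ∫ r in Set.Ioc (0 : ℝ) 1, r ^ (-(1 / 2) : ℝ) = 2 := by
    rw [← intervalIntegral.integral_of_le zero_le_one, integral_rpow (Or.inl (by norm_num))]
    norm_num
  calc ∫⁻ r in Set.Ioi (0 : ℝ), ENNReal.ofReal (|moser d L r| ^ p) * ENNReal.ofReal (r ^ θ)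
      ≤ ∫⁻ r in Set.Ioi (0 : ℝ), (Set.Ioc (0 : ℝ) 1).indicator (fun r =>
          ENNReal.ofReal (d ^ p * (2 * p) ^ p * r ^ (-(1 / 2) : ℝ))) r := by
        refine setLIntegral_mono' measurableSet_Ioi fun r (hr : 0 < r) => ?_
        rcases le_or_gt r 1 with h1 | h1
        · rw [Set.indicator_of_mem (Set.mem_Ioc.2 ⟨hr, h1⟩), ← ENNReal.ofReal_mul (by positivity)]
          refine ENNReal.ofReal_le_ofReal ?_
          have hl := Real.log_nonpos hr.le h1
          have hu : |moser d L r| ≤ d * -Real.log r := by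
            rw [abs_of_nonneg (moser_nonneg hd hL r), moser, max_eq_right (by linarith)]
            gcongr
            exact min_le_right _ _
          calc |moser d L r| ^ p * r ^ θ ≤ (d * -Real.log r) ^ p * 1 := by
                gcongr
                · exact Real.rpow_nonneg (mul_nonneg hd (by linarith)) _
                · exact Real.rpow_le_one hr.le h1 hθ
            _ = d ^ p * (-Real.log r) ^ p := by rw [mul_one, Real.mul_rpow hd (by linarith)]
            _ ≤ d ^ p * ((2 * p) ^ p * r ^ (-(1 / 2) : ℝ)) := by
                gcongr
                exact neg_log_rpow_le hp hr h1
            _ = _ := by ring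
        · simp [moser_of_one_le hL h1.le, Real.zero_rpow hp.ne']
    _ ≤ ∫⁻ r in Set.Ioc (0 : ℝ) 1, ENNReal.ofReal (d ^ p * (2 * p) ^ p * r ^ (-(1 / 2) : ℝ)) := by
        rw [← lintegral_indicator measurableSet_Ioc]
        exact setLIntegral_le_lintegral _ _
    _ = ENNReal.ofReal (d ^ p * (2 * (2 * p) ^ p)) := by
        rw [← ofReal_integral_eq_lintegral_ofReal (hint.const_mul _), integral_const_mul, hval]
        · congr 1
          ring
        · filter_upwards [ae_restrict_mem measurableSet_Ioc] with r hr
          have := hr.1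
          simp only [Pi.zero_apply]
          positivity

lemma wInt_moserDeriv_rpow_le {p d L : ℝ} (hp : 1 ≤ p) (hd : 0 ≤ d) (hL : 0 ≤ L) :
    wInt (p - 1) (fun r => |moserDeriv d L r| ^ p) ≤
      ENNReal.ofReal (omegaW (p - 1) * (d ^ p * L)) := by
  rw [wInt, ENNReal.ofReal_mul (omegaW_pos (by linarith)).le]
  gcongr
  have hexp : Real.exp (-L) ≤ 1 := Real.exp_le_one_iff.2 (by linarith)
  have hpos := Real.exp_pos (-L)
  have hint : IntegrableOn (fun r : ℝ => r⁻¹) (Set.Ioc (Real.exp (-L)) 1) :=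
    (ContinuousOn.integrableOn_Icc (continuousOn_id.inv₀ fun x hx =>
      (hpos.trans_le hx.1).ne')).mono_set Set.Ioc_subset_Icc_self
  have hval : ∫ r in Set.Ioc (Real.exp (-L)) 1, r⁻¹ = L := by
    rw [← intervalIntegral.integral_of_le hexp, integral_inv_of_pos hpos one_pos]
    simp
  calc ∫⁻ r in Set.Ioi (0 : ℝ),
        ENNReal.ofReal (|moserDeriv d L r| ^ p) * ENNReal.ofReal (r ^ (p - 1))
      ≤ ∫⁻ r in Set.Ioi (0 : ℝ), (Set.Ioc (Real.exp (-L)) 1).indicator (fun r =>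
          ENNReal.ofReal (d ^ p * r⁻¹)) r := by
        refine setLIntegral_mono' measurableSet_Ioi fun r (hr : 0 < r) => ?_
        by_cases h : r ∈ Set.Ioo (Real.exp (-L)) 1
        · rw [Set.indicator_of_mem (Set.Ioo_subset_Ioc_self h),
            ← ENNReal.ofReal_mul (by positivity), moserDeriv, Set.indicator_of_mem h]
          refine ENNReal.ofReal_le_ofReal (le_of_eq ?_)
          rw [abs_mul, abs_neg, abs_of_nonneg hd, abs_of_pos (inv_pos.2 hr),
            Real.mul_rpow hd (inv_pos.2 hr).le, Real.inv_rpow hr.le, Real.rpow_sub_one hr.ne']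
          have := (Real.rpow_pos_of_pos hr p).ne'
          field_simp
        · rw [moserDeriv, Set.indicator_of_notMem h]
          simp [Real.zero_rpow (by linarith : p ≠ 0)]
    _ ≤ ∫⁻ r in Set.Ioc (Real.exp (-L)) 1, ENNReal.ofReal (d ^ p * r⁻¹) := by
        rw [← lintegral_indicator measurableSet_Ioc]
        exact setLIntegral_le_lintegral _ _
    _ = ENNReal.ofReal (d ^ p * L) := by
        rw [← ofReal_integral_eq_lintegral_ofReal (hint.const_mul _), integral_const_mul, hval]
        filter_upwards [ae_restrict_mem measurableSet_Ioc] with r hr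
        have := hpos.trans hr.1
        simp only [Pi.zero_apply]
        positivity

lemma le_TMfunc_moser {p θ μ d L : ℝ} (hθ : 0 ≤ θ) :
    ENNReal.ofReal (omegaW θ * (phiP p (μ * |d * L| ^ (p / (p - 1))) *
      (Real.exp (-((θ + 1) * L)) / (θ + 1)))) ≤ TMfunc p θ μ (moser d L) := by
  rw [TMfunc, wInt, ENNReal.ofReal_mul (omegaW_pos hθ).le]
  gcongr
  have hpos := Real.exp_pos (-L)
  have hint : IntegrableOn (fun r : ℝ => r ^ θ) (Set.Ioc 0 (Real.exp (-L))) :=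
    (intervalIntegrable_iff_integrableOn_Ioc_of_le hpos.le).1
      (intervalIntegral.intervalIntegrable_rpow' (by linarith))
  have hval : ∫ r in Set.Ioc 0 (Real.exp (-L)), r ^ θ =
      Real.exp (-((θ + 1) * L)) / (θ + 1) := by
    rw [← intervalIntegral.integral_of_le hpos.le, integral_rpow (Or.inl (by linarith)),
      Real.zero_rpow (by linarith), sub_zero, ← Real.exp_mul]
    congr 2
    ring
  set Φ := phiP p (μ * |d * L| ^ (p / (p - 1)))
  calc ENNReal.ofReal (Φ * (Real.exp (-((θ + 1) * L)) / (θ + 1)))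
      = ∫⁻ r in Set.Ioc 0 (Real.exp (-L)), ENNReal.ofReal Φ * ENNReal.ofReal (r ^ θ) := by
        rw [lintegral_const_mul' _ _ ENNReal.ofReal_ne_top,
          ← ofReal_integral_eq_lintegral_ofReal hint, hval,
          ← ENNReal.ofReal_mul' (by positivity)]
        filter_upwards [ae_restrict_mem measurableSet_Ioc] with r hr
        exact Real.rpow_nonneg hr.1.le _
    _ = ∫⁻ r in Set.Ioc 0 (Real.exp (-L)),
          ENNReal.ofReal (phiP p (μ * |moser d L r| ^ (p / (p - 1)))) *
            ENNReal.ofReal (r ^ θ) := by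
        refine setLIntegral_congr_fun measurableSet_Ioc fun r hr => ?_
        simp only [moser_of_le_exp (d := d) hr.1 hr.2, Φ]
    _ ≤ _ := lintegral_mono_set Set.Ioc_subset_Ioi_self

lemma eventually_half_exp_le_phiP (p : ℝ) :
    ∀ᶠ t in atTop, Real.exp t / 2 ≤ phiP p t := by
  set k := ⌈p - 1⌉₊
  have ho : (fun t : ℝ => ∑ j ∈ Finset.range k, t ^ j / (Nat.factorial j : ℝ))
      =o[atTop] Real.exp := by
    refine Asymptotics.IsLittleO.fun_sum fun j _ => ?_
    simp_rw [div_eq_inv_mul]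
    exact (isLittleO_pow_exp_atTop (n := j)).const_mul_left _
  filter_upwards [ho.bound (half_pos one_pos)] with t ht
  rw [Real.norm_of_nonneg (Real.exp_pos t).le] at ht
  have hs := Real.summable_pow_div_factorial t
  have hphi : phiP p t = ∑' j : ℕ, t ^ (j + k) / (Nat.factorial (j + k) : ℝ) := by
    have hiff (j : ℕ) : p - 1 ≤ (j : ℝ) ↔ k ≤ j := Nat.ceil_le.symm
    have hsum : Summable fun j : ℕ =>
        if p - 1 ≤ (j : ℝ) then t ^ j / (Nat.factorial j : ℝ) else 0 :=
      hs.indicator {j : ℕ | p - 1 ≤ (j : ℝ)}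
    rw [phiP, ← hsum.sum_add_tsum_nat_add k, Finset.sum_eq_zero, zero_add]
    · refine tsum_congr fun j => if_pos ((hiff _).2 (Nat.le_add_left _ _))
    · exact fun j hj => if_neg fun h => by
        have := (hiff j).1 h
        have := Finset.mem_range.1 hj
        omega
  have hexp : Real.exp t = ∑' j : ℕ, t ^ j / (Nat.factorial j : ℝ) := by
    rw [Real.exp_eq_exp_ℝ, NormedSpace.exp_eq_tsum_div]
  rw [← hs.sum_add_tsum_nat_add k, ← hphi] at hexp
  have := le_abs_self (∑ j ∈ Finset.range k, t ^ j / (Nat.factorial j : ℝ))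
  rw [Real.norm_eq_abs] at ht
  linarith

/-- The slope for which `moser` has gradient norm one. -/
lemma normalized_slope_rpow {p w L : ℝ} (hp : 0 < p) (hw : 0 < w) (hL : 0 < L) :
    ((w * L) ^ (-(1 / p))) ^ p = (w * L)⁻¹ := by
  rw [← Real.rpow_mul (by positivity), neg_mul, one_div_mul_cancel hp.ne', Real.rpow_neg_one]

lemma muC_mul_normalized_height {p θ L : ℝ} (hp : 1 < p) (hL : 0 < L) :
    muC (p - 1) θ * |(omegaW (p - 1) * L) ^ (-(1 / p)) * L| ^ (p / (p - 1)) = (θ + 1) * L := by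
  have hw : 0 < omegaW (p - 1) := omegaW_pos (by linarith)
  have hp1 : p - 1 ≠ 0 := by linarith
  have hp0 : p ≠ 0 := by linarith
  rw [muC, mul_assoc, abs_of_pos (by positivity)]
  congr 1
  rw [Real.mul_rpow (by positivity) hL.le, ← Real.rpow_mul (by positivity),
    Real.mul_rpow hw.le hL.le]
  have h1 : -(1 / p) * (p / (p - 1)) = -(1 / (p - 1)) := by field_simp
  have h2 : p / (p - 1) = 1 / (p - 1) + 1 := by field_simp; ring
  rw [h1, h2, Real.rpow_add_one hL.ne', Real.rpow_neg hw.le, Real.rpow_neg hL.le]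
  have := (Real.rpow_pos_of_pos hw (1 / (p - 1))).ne'
  have := (Real.rpow_pos_of_pos hL (1 / (p - 1))).ne'
  field_simp

lemma wNorm_lt_top {θ q : ℝ} {u : ℝ → ℝ} (hq : 0 ≤ q)
    (h : wInt θ (fun r => |u r| ^ q) < ⊤) : wNorm θ q u < ⊤ :=
  ENNReal.rpow_lt_top_of_nonneg (by positivity) h.ne

lemma wNorm_rpow_neg {θ q : ℝ} (hq : q ≠ 0) (u : ℝ → ℝ) :
    wNorm θ q u ^ (-q) = (wInt θ fun r => |u r| ^ q)⁻¹ := by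
  rw [wNorm, ← ENNReal.rpow_mul, mul_neg, one_div_mul_cancel hq, ENNReal.rpow_neg_one]

theorem stmt_2 (p α θ : ℝ) (hp : 2 ≤ p) (hα : α = p - 1) (hθ : 0 ≤ θ) :
    TMSC p α θ (muC α θ) = ⊤ := by
  subst hα
  have hp0 : 0 < p := by linarith
  have hw : 0 < omegaW (p - 1) := omegaW_pos (by linarith)
  have hwθ := omegaW_pos hθ
  set w := omegaW (p - 1) with hw_def
  set B : ℝ := w / (2 * (θ + 1) * (2 * (2 * p) ^ p)) with hB
  have hBpos : 0 < B := by positivity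
  have hlim : Tendsto (fun L : ℝ => ENNReal.ofReal (B * L)) atTop (nhds ⊤) :=
    ENNReal.tendsto_ofReal_atTop.comp (tendsto_id.const_mul_atTop hBpos)
  refine top_le_iff.1 (le_of_tendsto hlim ?_)
  have hT : Tendsto (fun L : ℝ => (θ + 1) * L) atTop atTop :=
    tendsto_id.const_mul_atTop (by linarith)
  filter_upwards [eventually_gt_atTop 0, hT.eventually (eventually_half_exp_le_phiP p)]
    with L hL hphi
  set d := (w * L) ^ (-(1 / p)) with hd_def
  have hd : 0 < d := by positivity
  have hdp : d ^ p = (w * L)⁻¹ := normalized_slope_rpow hp0 hw hL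
  have hu := wInt_moser_rpow_le hp0 hθ hd.le hL.le
  have hu' : wInt (p - 1) (fun r => |moserDeriv d L r| ^ p) ≤ 1 := by
    refine (wInt_moserDeriv_rpow_le (by linarith) hd.le hL.le).trans_eq ?_
    rw [hdp, ← hw_def, ENNReal.ofReal_eq_one]
    field_simp
  have hmem : MemX p (p - 1) θ (moser d L) (moserDeriv d L) := {
    ftc_int := fun _ _ _ _ => (integrable_moserDeriv d L).intervalIntegrable
    ftc := fun _ _ ha hab => moser_sub_moser hL ha hab
    lim_zero := tendsto_const_nhds.congr' <| by
      filter_upwards [eventually_ge_atTop 1] with r hr using (moser_of_one_le hL.le hr).symm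
    fin_u := wNorm_lt_top hp0.le (hu.trans_lt ENNReal.ofReal_lt_top)
    fin_u' := wNorm_lt_top hp0.le (hu'.trans_lt ENNReal.one_lt_top) }
  have hne : moser d L ≠ 0 := fun h => by
    have h0 := congrFun h (Real.exp (-L))
    rw [moser_of_le_exp (Real.exp_pos _) le_rfl] at h0
    exact (mul_pos hd hL).ne' h0
  have hgrad : wNorm (p - 1) p (moserDeriv d L) ≤ 1 :=
    ENNReal.rpow_le_one hu' (by positivity)
  have hTM := le_TMfunc_moser (p := p) (μ := muC (p - 1) θ) (d := d) (L := L) hθ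
  rw [hd_def, hw_def, muC_mul_normalized_height (by linarith) hL, ← hw_def, ← hd_def] at hTM
  calc ENNReal.ofReal (B * L)
      ≤ (ENNReal.ofReal (omegaW θ * (d ^ p * (2 * (2 * p) ^ p))))⁻¹ *
          ENNReal.ofReal (omegaW θ * (phiP p ((θ + 1) * L) *
            (Real.exp (-((θ + 1) * L)) / (θ + 1)))) := by
        rw [← ENNReal.ofReal_inv_of_pos (by positivity), ← ENNReal.ofReal_mul (by positivity)]
        refine ENNReal.ofReal_le_ofReal ?_
        calc B * L = (omegaW θ * (d ^ p * (2 * (2 * p) ^ p)))⁻¹ *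
              (omegaW θ * (Real.exp ((θ + 1) * L) / 2 *
                (Real.exp (-((θ + 1) * L)) / (θ + 1)))) := by
              have := Real.exp_pos ((θ + 1) * L)
              rw [hdp, hB, Real.exp_neg]
              field_simp
          _ ≤ _ := by gcongr
    _ ≤ wNorm θ p (moser d L) ^ (-p) * TMfunc p θ (muC (p - 1) θ) (moser d L) := by
        rw [wNorm_rpow_neg hp0.ne']
        gcongr
    _ ≤ TMSC p (p - 1) θ (muC (p - 1) θ) :=
        le_iSup_of_le (moser d L) <| le_iSup_of_le (moserDeriv d L) <| le_iSup_of_le hmem <|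
          le_iSup_of_le hne <| le_iSup_of_le hgrad le_rfl
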